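/- Let (R,m) be a Cohen-Macaulay local ring of Krull dimension d and let C be a semidualizing R-module. Then H_m^d(C) is C-injective over R if and only if H_{m R̂}^d(C ⊗_R R̂) is (C ⊗_R R̂)-injective over the m-adic completion R̂ of R; moreover, C ⊗_R R̂ is a semidualizing R̂-module. -/

import Mathlib

/-!
Common definitions: semidualizing modules, `C`-injective modules and dimensions,
`G_C`-injective modules, Bass/Auslander classes, relative Cohen-Macaulayness,
Cohen-Macaulay and Gorenstein local rings, trivial extensions, ideal torsion.
-/

noncomputable section

open CategoryTheory TensorProduct

universe u

variable (R : Type u) [CommRing R]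

/-- An `R`-module `M` is `C`-injective if it is isomorphic to `Hom_R(C, I)`
for some injective `R`-module `I`. -/
def IsCInjective (C M : ModuleCat.{u} R) : Prop :=
  ∃ I : ModuleCat.{u} R, Module.Injective R I ∧ Nonempty (M ≃ₗ[R] (C →ₗ[R] I))

/-- `HasCoresDimLE R P n M` : the module `M` admits a coresolution of length at most `n`
by modules satisfying the property `P`. -/
def HasCoresDimLE (P : ModuleCat.{u} R → Prop) : ℕ → ModuleCat.{u} R → Prop
  | 0, M => Subsingleton M ∨ P M
  | n + 1, M => Subsingleton M ∨ ∃ (X : ModuleCat.{u} R) (f : M →ₗ[R] X),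
      P X ∧ Function.Injective f ∧
        HasCoresDimLE P n (ModuleCat.of R (X ⧸ LinearMap.range f))

/-- The coresolution dimension of `M` with respect to the class of modules satisfying `P`,
as an element of `ℕ∞` (`⊤` meaning no finite coresolution exists). -/
def coresDim (P : ModuleCat.{u} R → Prop) (M : ModuleCat.{u} R) : ℕ∞ :=
  sInf {d : ℕ∞ | ∃ n : ℕ, d = n ∧ HasCoresDimLE R P n M}

/-- The `C`-injective dimension of `M`. -/
def cinjDim (C M : ModuleCat.{u} R) : ℕ∞ :=
  coresDim R (IsCInjective R C) M

/-- The injective dimension of `M`. -/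
def injDim (M : ModuleCat.{u} R) : ℕ∞ :=
  coresDim R (fun N => Module.Injective R N) M

/-- A finitely generated `R`-module `C` is semidualizing if the natural map
`R → Hom_R(C,C)` is bijective and `Ext_R^i(C,C) = 0` for all `i ≥ 1`. -/
def IsSemidualizing (C : ModuleCat.{u} R) : Prop :=
  Module.Finite R C ∧ Function.Bijective (LinearMap.lsmul R C) ∧
    ∀ i : ℕ, 1 ≤ i →
      Subsingleton (((Ext R (ModuleCat.{u} R) i).obj (Opposite.op C)).obj C)

/-- A dualizing module is a semidualizing module of finite injective dimension. -/
def IsDualizing (C : ModuleCat.{u} R) : Prop :=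
  IsSemidualizing R C ∧ injDim R C ≠ ⊤

/-- A complete `I_C I`-resolution: an exact complex `Y` (with `d i : Y (i+1) → Y i`)
which stays exact after applying `Hom_R(I, -)` for every `C`-injective `I`, whose terms
in positive degrees are `C`-injective and whose terms in degrees `≤ 0` are injective. -/
structure CompleteICIResolution (C : ModuleCat.{u} R) where
  Y : ℤ → ModuleCat.{u} R
  d : (i : ℤ) → (Y (i + 1) →ₗ[R] Y i)
  exact : ∀ i : ℤ, Function.Exact (d (i + 1)) (d i)
  cinj_pos : ∀ i : ℤ, 0 < i → IsCInjective R C (Y i)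
  inj_nonpos : ∀ i : ℤ, i ≤ 0 → Module.Injective R (Y i)
  homExact : ∀ I : ModuleCat.{u} R, IsCInjective R C I → ∀ i : ℤ,
    Function.Exact (fun f : I →ₗ[R] Y (i + 1 + 1) => (d (i + 1)).comp f)
      (fun f : I →ₗ[R] Y (i + 1) => (d i).comp f)

/-- A module is `G_C`-injective if it is the kernel of the degree-`0` differential of some
complete `I_C I`-resolution. -/
def IsGCInjective (C M : ModuleCat.{u} R) : Prop :=
  ∃ res : CompleteICIResolution R C,
    Nonempty (M ≃ₗ[R] ↥(LinearMap.ker (res.d (-1))))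

/-- The `G_C`-injective dimension of `M`. -/
def gcinjDim (C M : ModuleCat.{u} R) : ℕ∞ :=
  coresDim R (IsGCInjective R C) M

/-- `M` is relative Cohen-Macaulay with respect to `a`: there is exactly one
non-vanishing local cohomology module of `M` with respect to `a`. -/
def IsRelativeCM (a : Ideal R) (M : ModuleCat.{u} R) : Prop :=
  ∃! n : ℕ, Nontrivial ((localCohomology a n).obj M)

/-- `M` is relative Cohen-Macaulay with respect to `a`, with (unique) non-vanishing
local cohomology in degree `n`. -/
def IsRelativeCMAt (a : Ideal R) (n : ℕ) (M : ModuleCat.{u} R) : Prop :=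
  Nontrivial ((localCohomology a n).obj M) ∧
    ∀ i : ℕ, i ≠ n → Subsingleton ((localCohomology a i).obj M)

/-- The cohomological dimension `cd(a, M)`: the largest `i` with `H_a^i(M) ≠ 0`. -/
def lcCohomDim (a : Ideal R) (M : ModuleCat.{u} R) : ℕ :=
  sSup {i : ℕ | Nontrivial ((localCohomology a i).obj M)}

/-- The grade `grade(a, M)`: the least `i` with `H_a^i(M) ≠ 0`. -/
def lcGrade (a : Ideal R) (M : ModuleCat.{u} R) : ℕ :=
  sInf {i : ℕ | Nontrivial ((localCohomology a i).obj M)}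

/-- A Noetherian local ring is Cohen-Macaulay iff `H_m^i(R) = 0` for all `i ≠ dim R`
(Grothendieck's characterization, taken here as the definition). -/
def IsCohenMacaulayLocalRing (S : Type u) [CommRing S] [IsLocalRing S] : Prop :=
  ∀ i : ℕ, (i : WithBot ℕ∞) ≠ ringKrullDim S →
    Subsingleton ((localCohomology (IsLocalRing.maximalIdeal S) i).obj (ModuleCat.of S S))

/-- A local ring is Gorenstein if it has finite injective dimension over itself. -/
def IsGorensteinLocalRing (S : Type u) [CommRing S] : Prop :=
  injDim S (ModuleCat.of S S) ≠ ⊤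

/-- The `a`-torsion submodule `Γ_a(M)` of `M`. -/
def idealTorsion (a : Ideal R) (M : Type u) [AddCommGroup M] [Module R M] :
    Submodule R M :=
  ⨆ n : ℕ, Submodule.torsionBySet R M ((a ^ n : Ideal R) : Set R)

/-- The Krull dimension of a module, `dim_S N = dim (S / ann_S N)`. -/
def moduleKrullDim (S : Type u) [CommRing S] (N : Type u) [AddCommGroup N] [Module S N] :
    WithBot ℕ∞ :=
  ringKrullDim (S ⧸ Module.annihilator S N)

/-- `ht_M(a) = inf { dim_{R_p} M_p  |  p ∈ Supp (M / a M) }`. -/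
def heightWRT (a : Ideal R) (M : Type u) [AddCommGroup M] [Module R M] : WithBot ℕ∞ :=
  ⨅ (p : PrimeSpectrum R) (_ : p ∈ Module.support R (M ⧸ (a • (⊤ : Submodule R M)))),
    moduleKrullDim (Localization.AtPrime p.asIdeal) (LocalizedModule p.asIdeal.primeCompl M)

/-- Membership in the Bass class `B_C(R)`. -/
def MemBassClass (C M : ModuleCat.{u} R) : Prop :=
  (∀ i : ℕ, 1 ≤ i →
      Subsingleton (((Ext R (ModuleCat.{u} R) i).obj (Opposite.op C)).obj M)) ∧
  (∀ i : ℕ, 1 ≤ i →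
      Subsingleton (((Tor (ModuleCat.{u} R) i).obj C).obj (ModuleCat.of R (C →ₗ[R] M)))) ∧
  Function.Bijective
    (TensorProduct.lift ((LinearMap.id : (C →ₗ[R] M) →ₗ[R] (C →ₗ[R] M)).flip))

/-- Membership in the Auslander class `A_C(R)`. -/
def MemAuslanderClass (C M : ModuleCat.{u} R) : Prop :=
  (∀ i : ℕ, 1 ≤ i →
      Subsingleton (((Tor (ModuleCat.{u} R) i).obj C).obj M)) ∧
  (∀ i : ℕ, 1 ≤ i →
      Subsingleton (((Ext R (ModuleCat.{u} R) i).obj (Opposite.op C)).obj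
        (ModuleCat.of R (↥C ⊗[R] ↥M)))) ∧
  Function.Bijective ((TensorProduct.mk R ↥C ↥M).flip)

/-- `HasResDimLE R P n M` : `M` admits a resolution of length at most `n`
by modules satisfying `P`. -/
def HasResDimLE (P : ModuleCat.{u} R → Prop) : ℕ → ModuleCat.{u} R → Prop
  | 0, M => Subsingleton M ∨ P M
  | n + 1, M => Subsingleton M ∨ ∃ (X : ModuleCat.{u} R) (f : X →ₗ[R] M),
      P X ∧ Function.Surjective f ∧
        HasResDimLE P n (ModuleCat.of R ↥(LinearMap.ker f))

/-- The projective dimension of `M`. -/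
def projDim (M : ModuleCat.{u} R) : ℕ∞ :=
  sInf {d : ℕ∞ | ∃ n : ℕ, d = n ∧ HasResDimLE R (fun N => Module.Projective R N) n M}

/-- The first projection of the trivial extension `R ⋉ C`, as a ring homomorphism. -/
def trivExtFst (C : Type u) [AddCommGroup C] [Module R C] [Module Rᵐᵒᵖ C]
    [IsCentralScalar R C] : TrivSqZeroExt R C →+* R where
  toFun := TrivSqZeroExt.fst
  map_one' := TrivSqZeroExt.fst_one (R := R) (M := C)
  map_mul' := TrivSqZeroExt.fst_mul
  map_zero' := TrivSqZeroExt.fst_zero (R := R) (M := C)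
  map_add' := TrivSqZeroExt.fst_add

/-- The ideal `a ⊕ C` of the trivial extension `R ⋉ C`. -/
def trivExtIdeal (a : Ideal R) (C : Type u) [AddCommGroup C] [Module R C] [Module Rᵐᵒᵖ C]
    [IsCentralScalar R C] : Ideal (TrivSqZeroExt R C) :=
  Ideal.comap (trivExtFst R C) a

/-- An `R`-module `M`, viewed as a module over the trivial extension `R ⋉ C` via the
natural surjection `R ⋉ C → R`. -/
def trivExtModuleCat (C : Type u) [AddCommGroup C] [Module R C] [Module Rᵐᵒᵖ C]
    [IsCentralScalar R C] (M : Type u) [AddCommGroup M] [Module R M] :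
    ModuleCat.{u} (TrivSqZeroExt R C) :=
  letI := Module.compHom M (trivExtFst R C)
  ModuleCat.of (TrivSqZeroExt R C) M

end

section

/-- An algebra over a Noetherian ring that is complete for the extension of an ideal `I` and
generated by `R` modulo `I` is Noetherian. -/
theorem isNoetherianRing_of_isAdicComplete {R S : Type*} [CommRing R] [CommRing S] [IsNoetherianRing R]
    [Algebra R S] (I : Ideal R) (hc : IsAdicComplete (I.map (algebraMap R S)) S)
    (hs : Function.Surjective ((Ideal.Quotient.mk (I.map (algebraMap R S))).comp (algebraMap R S))) :
    IsNoetherianRing S := by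
  set J := I.map (algebraMap R S) with hJ
  obtain ⟨n, a, ha⟩ := Submodule.fg_iff_exists_fin_generating_family.mp (IsNoetherian.noetherian I)
  let e : MvPolynomial (Fin n) R →ₐ[R] S := MvPolynomial.aeval (fun i => algebraMap R S (a i))
  have he : MvPolynomial.idealOfVars (Fin n) R ≤ J.comap e.toRingHom := by
    rw [MvPolynomial.idealOfVars, Ideal.span_le]
    rintro _ ⟨i, rfl⟩
    simp only [Ideal.coe_comap, Set.mem_preimage, SetLike.mem_coe, e, AlgHom.toRingHom_eq_coe,
      RingHom.coe_coe, MvPolynomial.aeval_X]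
    refine Ideal.mem_map_of_mem _ ?_
    rw [← ha]
    exact Submodule.subset_span ⟨i, rfl⟩
  have hp (k : ℕ) : MvPolynomial.idealOfVars (Fin n) R ^ k ≤ (J ^ k).comap e.toRingHom :=
    (Ideal.pow_right_mono he k).trans (Ideal.le_comap_pow _ k)
  let f (k : ℕ) : MvPowerSeries (Fin n) R →+* S ⧸ J ^ k :=
    (Ideal.quotientMap (J ^ k) e.toRingHom (hp k)).comp
      (MvPowerSeries.truncTotalAlgHom (Fin n) R k).toRingHom
  have hfa (k : ℕ) (p) : f k p = Ideal.Quotient.mk (J ^ k) (e (MvPowerSeries.truncTotal k p)) := rfl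
  have hf {k l : ℕ} (hle : k ≤ l) :
      (Ideal.Quotient.factorPow J hle).comp (f l) = f k := by
    ext p
    rw [RingHom.comp_apply, hfa, hfa]
    rw [Ideal.Quotient.factor_mk, Ideal.Quotient.mk_eq_mk_iff_sub_mem, ← map_sub]
    exact hp k (MvPowerSeries.truncTotal_sub_truncTotal_mem_pow_idealOfVars hle le_rfl p)
  let F := IsAdicComplete.liftRingHom J f (fun {_ _} hle => hf hle)
  have hFc (p : MvPolynomial (Fin n) R) : F p = e p := by
    rw [IsHausdorff.eq_iff_smodEq (I := J)]
    intro k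
    rw [SModEq.sub_mem, smul_eq_mul, Ideal.mul_top, ← Ideal.Quotient.mk_eq_mk_iff_sub_mem,
      IsAdicComplete.mk_liftRingHom, hfa, Ideal.Quotient.mk_eq_mk_iff_sub_mem, ← map_sub]
    refine hp k ?_
    rw [MvPolynomial.mem_pow_idealOfVars_iff']
    intro x hx
    rw [MvPolynomial.coeff_sub, MvPowerSeries.coeff_truncTotal _ hx, MvPolynomial.coeff_coe, sub_self]
  have hmap : (Ideal.span (Set.range MvPowerSeries.X) : Ideal (MvPowerSeries (Fin n) R)).map F = J := by
    rw [Ideal.map_span, ← Set.range_comp, hJ, ← ha, Ideal.submodule_span_eq, Ideal.map_span, ← Set.range_comp]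
    congr 2
    ext i
    simpa [e] using hFc (MvPolynomial.X i)
  refine isNoetherianRing_of_surjective (MvPowerSeries (Fin n) R) S F ?_
  have : IsHausdorff (Ideal.map F (Ideal.span (Set.range MvPowerSeries.X))) S := by
    rw [hmap]; infer_instance
  refine surjective_of_mk_map_comp_surjective (I := Ideal.span (Set.range MvPowerSeries.X)) F ?_
  rw [hmap]
  intro y
  obtain ⟨r, rfl⟩ := hs y
  refine ⟨(MvPolynomial.C r : MvPolynomial (Fin n) R), ?_⟩
  rw [RingHom.comp_apply, hFc]
  simp [e]

end

section

open IsLocalRing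

/-- Every power of the extension of `I` is dense: `R → S / I^k S` is surjective for all `k`. -/
def IdealDense {R : Type*} (S : Type*) [CommRing R] [CommRing S] [Algebra R S] (I : Ideal R) : Prop :=
  ∀ (k : ℕ) (s : S), ∃ r : R, s - algebraMap R S r ∈ I.map (algebraMap R S) ^ k

theorem idealDense_adicCompletion (R : Type*) [CommRing R] [IsNoetherianRing R] (I : Ideal R) :
    IdealDense (AdicCompletion I R) I := by
  intro k s
  obtain ⟨r, hr⟩ := Submodule.mkQ_surjective _ (AdicCompletion.eval I R k s)
  refine ⟨r, ?_⟩
  have h1 : s - algebraMap R (AdicCompletion I R) r ∈ LinearMap.ker (AdicCompletion.eval I R k) := by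
    rw [LinearMap.mem_ker, map_sub, sub_eq_zero, ← hr]
    rfl
  rw [← AdicCompletion.pow_smul_top_eq_ker_eval I.fg_of_isNoetherianRing, Ideal.smul_top_eq_map,
    Submodule.restrictScalars_mem, Ideal.map_pow] at h1
  exact h1

theorem isNoetherianRing_adicCompletion (R : Type*) [CommRing R] [IsNoetherianRing R] [IsLocalRing R] :
    IsNoetherianRing (AdicCompletion (maximalIdeal R) R) := by
  refine isNoetherianRing_of_isAdicComplete (maximalIdeal R) ?_ ?_
  · rw [← AdicCompletion.maximalIdeal_eq_map]
    infer_instance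
  · intro y
    obtain ⟨s, rfl⟩ := Ideal.Quotient.mk_surjective y
    obtain ⟨r, hr⟩ := idealDense_adicCompletion R (maximalIdeal R) 1 s
    refine ⟨r, ?_⟩
    rw [pow_one] at hr
    exact (Ideal.Quotient.mk_eq_mk_iff_sub_mem _ _).mpr hr |>.symm

theorem faithfullyFlat_adicCompletion (R : Type*) [CommRing R] [IsNoetherianRing R] [IsLocalRing R] :
    Module.FaithfullyFlat R (AdicCompletion (maximalIdeal R) R) := by
  have := AdicCompletion.flat_of_isNoetherian (maximalIdeal R)
  exact Module.FaithfullyFlat.of_flat_of_isLocalHom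

end

noncomputable section

open CategoryTheory
universe u
namespace FiniteFreeResolution
variable {R : Type u} [CommRing R]

theorem exists_cover (M : ModuleCat.{u} R) [Module.Finite R M] :
    ∃ (n : ℕ) (f : (Fin n → R) →ₗ[R] M), Function.Surjective f :=
  Module.Finite.exists_fin' R M

/-- The rank of a chosen finite free cover. -/
def rank (M : ModuleCat.{u} R) [Module.Finite R M] : ℕ := (exists_cover M).choose

/-- A chosen finite free cover. -/
def cover (M : ModuleCat.{u} R) [Module.Finite R M] : (Fin (rank M) → R) →ₗ[R] M :=
  (exists_cover M).choose_spec.choose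

theorem cover_surjective (M : ModuleCat.{u} R) [Module.Finite R M] :
    Function.Surjective (cover M) := (exists_cover M).choose_spec.choose_spec

variable [IsNoetherianRing R] (X : ModuleCat.{u} R) [Module.Finite R X]

/-- Iterated syzygies of a finite module. -/
def syzygy : ℕ → {M : ModuleCat.{u} R // Module.Finite R M}
  | 0 => ⟨X, inferInstance⟩
  | n + 1 => haveI := (syzygy n).2
    ⟨ModuleCat.of R (LinearMap.ker (cover (syzygy n).1)), inferInstance⟩

instance (n : ℕ) : Module.Finite R (syzygy X n).1 := (syzygy X n).2

/-- The terms of the finite free resolution. -/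
abbrev term (n : ℕ) : ModuleCat.{u} R := ModuleCat.of R (Fin (rank (syzygy X n).1) → R)

/-- The inclusion of a syzygy in the previous term. -/
def incl (n : ℕ) : (syzygy X (n + 1)).1 →ₗ[R] term X n :=
  (LinearMap.ker (cover (syzygy X n).1)).subtype

/-- The differentials of the finite free resolution. -/
def diff (n : ℕ) : term X (n + 1) ⟶ term X n :=
  ModuleCat.ofHom (incl X n ∘ₗ cover (syzygy X (n + 1)).1)

theorem cover_exact_diff (n : ℕ) : Function.Exact (diff X n) (cover (syzygy X n).1) := by
  intro y
  constructor
  · intro h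
    obtain ⟨x, hx⟩ := cover_surjective (syzygy X (n + 1)).1 ⟨y, h⟩
    exact ⟨x, congrArg Subtype.val hx⟩
  · rintro ⟨x, rfl⟩
    exact (cover (syzygy X (n + 1)).1 x).2

theorem diff_exact (n : ℕ) : Function.Exact (diff X (n + 1)) (diff X n) := by
  intro y
  refine Iff.trans ?_ (cover_exact_diff X (n + 1) y)
  exact ⟨fun h => Subtype.ext h, fun h => congrArg Subtype.val h⟩

/-- The finite free resolution as a chain complex. -/
def cplx : ChainComplex (ModuleCat.{u} R) ℕ :=
  ChainComplex.of (term X) (diff X) (fun n => by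
    ext1; exact (diff_exact X n).linearMap_comp_eq_zero)

theorem cplx_d (n : ℕ) : (cplx X).d (n + 1) n = diff X n := ChainComplex.of_d _ _ _

/-- A resolution of a finite module over a Noetherian ring by finite free modules. -/
def resolution : ProjectiveResolution X where
  complex := cplx X
  projective n := by
    change Projective (term X n)
    infer_instance
  π := (ChainComplex.toSingle₀Equiv _ _).symm ⟨ModuleCat.ofHom (cover X), by
    rw [cplx_d]; ext1; exact (cover_exact_diff X 0).linearMap_comp_eq_zero⟩
  quasiIso := ⟨fun n => by
    rcases n with _ | n
    · rw [ChainComplex.quasiIsoAt₀_iff, ShortComplex.quasiIso_iff_of_zeros']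
      · refine ⟨?_, ?_⟩
        · rw [ShortComplex.ShortExact.moduleCat_exact_iff_function_exact]
          change Function.Exact ((cplx X).d 1 0) (cover X)
          rw [cplx_d]
          exact cover_exact_diff X 0
        · exact (ModuleCat.epi_iff_surjective _).2 (cover_surjective X)
      all_goals rfl
    · rw [quasiIsoAt_iff_exactAt']
      · rw [HomologicalComplex.exactAt_iff' _ (n + 1 + 1) (n + 1) n (by simp) (by simp)]
        rw [ShortComplex.ShortExact.moduleCat_exact_iff_function_exact]
        simp only [HomologicalComplex.sc', HomologicalComplex.shortComplexFunctor', cplx_d]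
        exact diff_exact X n
      · apply ChainComplex.exactAt_succ_single_obj⟩

end FiniteFreeResolution

end

noncomputable section

open CategoryTheory Limits

namespace CategoryTheory

/-- Horizontal pasting of commutative squares. -/
theorem paste_squares {A : Type*} [Category* A] {X₁ X₂ X₃ Y₁ Y₂ Y₃ : A} {f₁ : X₁ ⟶ X₂} {f₂ : X₂ ⟶ X₃}
    {g₁ : Y₁ ⟶ Y₂} {g₂ : Y₂ ⟶ Y₃} {a : X₁ ⟶ Y₁} {b : X₂ ⟶ Y₂} {c : X₃ ⟶ Y₃}
    (h₁ : a ≫ g₁ = f₁ ≫ b) (h₂ : b ≫ g₂ = f₂ ≫ c) : a ≫ g₁ ≫ g₂ = (f₁ ≫ f₂) ≫ c := by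
  rw [← Category.assoc, h₁, Category.assoc, h₂, Category.assoc]

end CategoryTheory

namespace CategoryTheory.Functor

variable {A B E E' : Type*} [Category* A] [Category* B] [Category* E] [Category* E']
  [Abelian A] [Abelian B] [Abelian E] [Abelian E'] [HasProjectiveResolutions A]
  [HasProjectiveResolutions B]

/-- Precomposition of a left derived functor with an exact functor preserving projectives. -/
def compLeftDerivedIso (F : A ⥤ B) (G : B ⥤ E) [F.Additive] [G.Additive] [F.PreservesHomology]
    [F.PreservesProjectiveObjects] (n : ℕ) :
    F ⋙ G.leftDerived n ≅ (F ⋙ G).leftDerived n :=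
  NatIso.ofComponents
    (fun X => (F.mapProjectiveResolution (projectiveResolution X)).isoLeftDerivedObj G n ≪≫
      ((projectiveResolution X).isoLeftDerivedObj (F ⋙ G) n).symm)
    (fun {X Y} f => by
      let φ := ProjectiveResolution.lift f (projectiveResolution X) (projectiveResolution Y)
      have hφ : φ.f 0 ≫ (projectiveResolution Y).π.f 0 = (projectiveResolution X).π.f 0 ≫ f :=
        ProjectiveResolution.lift_commutes_zero f _ _
      have h1 := ProjectiveResolution.isoLeftDerivedObj_inv_naturality f
        (projectiveResolution X) (projectiveResolution Y) φ hφ (F ⋙ G) n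
      have h2 := ProjectiveResolution.isoLeftDerivedObj_hom_naturality (F.map f)
        (F.mapProjectiveResolution (projectiveResolution X))
        (F.mapProjectiveResolution (projectiveResolution Y))
        ((F.mapHomologicalComplex _).map φ) (by
          simp only [mapProjectiveResolution_π, HomologicalComplex.comp_f]
          have h3 := congrArg F.map hφ
          simp only [map_comp] at h3
          have h4 := (HomologicalComplex.singleMapHomologicalComplex F (ComplexShape.down ℕ) 0).hom.naturality f
          have h5 := congr_arg (fun t => HomologicalComplex.Hom.f t 0) h4
          simp only [HomologicalComplex.comp_f] at h5
          exact paste_squares (h3.trans (F.map_comp _ _))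
            (Eq.trans (congrArg (· ≫ _) (congrArg F.map (ChainComplex.single₀_map_f_zero f)).symm)
              (h5.trans (congrArg (_ ≫ ·) (ChainComplex.single₀_map_f_zero (F.map f)))))) G n
      exact paste_squares h2 h1.symm)

/-- Postcomposition of a left derived functor with an exact functor. -/
def leftDerivedCompIso (G : A ⥤ E) (K : E ⥤ E') [G.Additive] [K.Additive] [K.PreservesHomology]
    (n : ℕ) : G.leftDerived n ⋙ K ≅ (G ⋙ K).leftDerived n :=
  NatIso.ofComponents
    (fun X => K.mapIso ((projectiveResolution X).isoLeftDerivedObj G n) ≪≫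
      (ShortComplex.mapHomologyIso _ K).symm ≪≫
      ((projectiveResolution X).isoLeftDerivedObj (G ⋙ K) n).symm)
    (fun {X Y} f => by
      let φ := ProjectiveResolution.lift f (projectiveResolution X) (projectiveResolution Y)
      have hφ : φ.f 0 ≫ (projectiveResolution Y).π.f 0 = (projectiveResolution X).π.f 0 ≫ f :=
        ProjectiveResolution.lift_commutes_zero f _ _
      have h1 := ProjectiveResolution.isoLeftDerivedObj_inv_naturality f
        (projectiveResolution X) (projectiveResolution Y) φ hφ (G ⋙ K) n
      have h2 := ProjectiveResolution.isoLeftDerivedObj_hom_naturality f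
        (projectiveResolution X) (projectiveResolution Y) φ hφ G n
      have h3 := congrArg K.map h2
      simp only [map_comp] at h3
      exact paste_squares h3 (paste_squares (ShortComplex.mapHomologyIso_inv_naturality
        ((HomologicalComplex.shortComplexFunctor _ _ n).map ((G.mapHomologicalComplex _).map φ)) K)
        h1.symm))

end CategoryTheory.Functor

end

noncomputable section

open CategoryTheory Limits TensorProduct
universe u

/-- Left derived functors of isomorphic functors are isomorphic. -/
def leftDerivedMapIso {A E : Type*} [Category* A] [Category* E] [Abelian A] [Abelian E]
    [HasProjectiveResolutions A] {F G : A ⥤ E} [F.Additive] [G.Additive] (α : F ≅ G) (n : ℕ) :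
    F.leftDerived n ≅ G.leftDerived n where
  hom := NatTrans.leftDerived α.hom n
  inv := NatTrans.leftDerived α.inv n
  hom_inv_id := by rw [← NatTrans.leftDerived_comp, α.hom_inv_id, NatTrans.leftDerived_id]
  inv_hom_id := by rw [← NatTrans.leftDerived_comp, α.inv_hom_id, NatTrans.leftDerived_id]

variable (R S : Type u) [CommRing R] [CommRing S] [Algebra R S]

/-- Base change of modules along an algebra, as a functor. -/
def baseChangeFunctor : ModuleCat.{u} R ⥤ ModuleCat.{u} S where
  obj M := ModuleCat.of S (S ⊗[R] M)
  map f := ModuleCat.ofHom (f.hom.baseChange S)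
  map_id M := by ext1; exact LinearMap.baseChange_id
  map_comp f g := by ext1; exact LinearMap.baseChange_comp _ _

instance : (baseChangeFunctor R S).Additive where
  map_add {X Y f g} := by ext1; exact LinearMap.baseChange_add _ _

instance : (baseChangeFunctor R S).PreservesProjectiveObjects where
  projective_obj {P} hP := by
    rw [← IsProjective.iff_projective] at hP
    change Projective (ModuleCat.of S (S ⊗[R] P))
    rw [← IsProjective.iff_projective]
    infer_instance

instance [Module.Flat R S] : (baseChangeFunctor R S).PreservesHomology := by
  have := ((Functor.exact_tfae (baseChangeFunctor R S)).out 1 3).mp (fun T hT => by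
    rw [ShortComplex.ShortExact.moduleCat_exact_iff_function_exact] at hT ⊢
    have := Module.Flat.lTensor_exact S hT
    exact this)
  have h1 := this.1
  have h2 := this.2
  infer_instance

/-- Restriction of scalars to the base ring of an algebra. -/
abbrev restrictFunctor : ModuleCat.{u} S ⥤ ModuleCat.{u} R :=
  ModuleCat.restrictScalars (algebraMap R S)

instance : (restrictFunctor R S).op.PreservesHomology := inferInstance
instance : (restrictFunctor R S).op.Additive := inferInstance

/-- The functor `Hom(-, M)` with values in the opposite category. -/
abbrev homInto (M : ModuleCat.{u} R) : ModuleCat.{u} R ⥤ (ModuleCat.{u} R)ᵒᵖ :=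
  ((linearYoneda R (ModuleCat.{u} R)).obj M).rightOp

instance (M : ModuleCat.{u} R) : (homInto R M).Additive := inferInstance

variable {R S} in
/-- The adjunction between base change and restriction of scalars on hom modules. -/
def homBaseChangeEquiv (X : ModuleCat.{u} R) (N : ModuleCat.{u} S) :
    (X ⟶ (restrictFunctor R S).obj N) ≃ₗ[R]
      (restrictFunctor R S).obj (ModuleCat.of S ((baseChangeFunctor R S).obj X ⟶ N)) :=
  letI : Module S ((restrictFunctor R S).obj N) := inferInstanceAs (Module S N)
  haveI : IsScalarTower R S ((restrictFunctor R S).obj N) :=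
    IsScalarTower.of_algebraMap_smul (fun _ _ => rfl)
  let e := LinearMap.liftBaseChangeEquiv (R := R) (M := X) (N := (restrictFunctor R S).obj N) S
  { toFun f := ModuleCat.ofHom (X := S ⊗[R] X) (Y := N) (e f.hom)
    map_add' f g := ModuleCat.hom_ext (map_add e f.hom g.hom)
    map_smul' r f := ModuleCat.hom_ext
      ((congrArg e (algebraMap_smul S r f.hom).symm).trans (map_smul e (algebraMap R S r) f.hom))
    invFun g := ModuleCat.ofHom (X := X) (Y := (restrictFunctor R S).obj N)
      (e.symm (ModuleCat.Hom.hom (R := S) (A := ModuleCat.of S (S ⊗[R] X)) (B := N) g))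
    left_inv _ := ModuleCat.hom_ext (e.symm_apply_apply _)
    right_inv _ := ModuleCat.hom_ext (e.apply_symm_apply _) }

/-- Naturality of `homBaseChangeEquiv`. -/
def homIntoBaseChangeIso (N : ModuleCat.{u} S) :
    baseChangeFunctor R S ⋙ homInto S N ⋙ (restrictFunctor R S).op ≅
      homInto R ((restrictFunctor R S).obj N) :=
  NatIso.ofComponents (fun X => (homBaseChangeEquiv X N).toModuleIso.op) (fun {X Y} f => by
    apply Quiver.Hom.unop_inj
    refine ModuleCat.hom_ext (LinearMap.ext fun g => ModuleCat.hom_ext ?_)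
    refine LinearMap.ext fun t => ?_
    induction t using TensorProduct.induction_on with
    | zero => exact (map_zero _).trans (map_zero _).symm
    | tmul s x => rfl
    | add a b ha hb => exact (map_add _ a b).trans ((congr_arg₂ (· + ·) ha hb).trans (map_add _ a b).symm))

variable [Module.Flat R S]

/-- `Ext_S(S ⊗ X, N)` is `Ext_R(X, N)` for flat `S`. -/
def leftDerivedHomIntoIso (N : ModuleCat.{u} S) (n : ℕ) :
    baseChangeFunctor R S ⋙ (homInto S N).leftDerived n ⋙ (restrictFunctor R S).op ≅
      (homInto R ((restrictFunctor R S).obj N)).leftDerived n :=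
  Functor.isoWhiskerLeft _ (Functor.leftDerivedCompIso _ _ _) ≪≫ Functor.compLeftDerivedIso _ _ _ ≪≫
  leftDerivedMapIso (homIntoBaseChangeIso R S N) n

end

section

open TensorProduct

section
variable {R S : Type*} [CommRing R] [CommRing S] [Algebra R S]
  {A B D A' B' D' : Type*} [AddCommGroup A] [AddCommGroup B] [AddCommGroup D]
  [Module R A] [Module R B] [Module R D] [AddCommGroup A'] [AddCommGroup B'] [AddCommGroup D']
  [Module R A'] [Module R B'] [Module R D'] [Module S A'] [Module S B'] [Module S D']
  [IsScalarTower R S A'] [IsScalarTower R S B'] [IsScalarTower R S D']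
  {a : A →ₗ[R] B} {b : B →ₗ[R] D} {a' : A' →ₗ[S] B'} {b' : B' →ₗ[S] D'}
  {α : A →ₗ[R] A'} {β : B →ₗ[R] B'} {δ : D →ₗ[R] D'}

theorem IsBaseChange.equiv_baseChange_comm (hα : IsBaseChange S α) (hβ : IsBaseChange S β)
    (ha : ∀ x, a' (α x) = β (a x)) (t : S ⊗[R] A) :
    a' (hα.equiv t) = hβ.equiv (a.baseChange S t) := by
  induction t with
  | zero => simp
  | tmul s x => simp [IsBaseChange.equiv_tmul, ha]
  | add x y hx hy => simp [hx, hy]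

/-- Base change along a faithfully flat algebra reflects membership in a range. -/
theorem IsBaseChange.mem_range_of_mem_range [Module.FaithfullyFlat R S]
    (hα : IsBaseChange S α) (hβ : IsBaseChange S β) (ha : ∀ x, a' (α x) = β (a x))
    {y : B} (hy : β y ∈ LinearMap.range a') : y ∈ LinearMap.range a := by
  obtain ⟨x, hx⟩ := hy
  obtain ⟨t, rfl⟩ := hα.equiv.surjective x
  rw [hα.equiv_baseChange_comm hβ ha] at hx
  have h1 : β y = hβ.equiv ((1 : S) ⊗ₜ[R] y) := by simp [IsBaseChange.equiv_tmul]
  rw [h1] at hx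
  have h2 := hβ.equiv.injective hx
  have h3 : (1 : S) ⊗ₜ[R] (LinearMap.range a).mkQ y = 0 := by
    have : (LinearMap.range a).mkQ.baseChange S (a.baseChange S t) = 0 := by
      rw [← LinearMap.comp_apply, ← LinearMap.baseChange_comp, LinearMap.range_mkQ_comp]
      simp
    rw [h2] at this
    simpa using this
  have h4 := Module.FaithfullyFlat.tensorProduct_mk_injective (A := R) (B := S) (B ⧸ LinearMap.range a)
    (a₁ := (LinearMap.range a).mkQ y) (a₂ := 0) (by simpa using h3)
  simpa using h4

omit [IsScalarTower R S A'] in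
/-- If cycles of `A → B → D` are boundaries up to multiplication by `I` and every element of `S` is
congruent to an element of `R` modulo `I S`, then cycles of the base change come from cycles
modulo boundaries. -/
theorem IsBaseChange.exists_cycle [Module.Flat R S] (I : Ideal R)
    (hI : ∀ s : S, ∃ r : R, s - algebraMap R S r ∈ I.map (algebraMap R S))
    (hβ : IsBaseChange S β) (hδ : IsBaseChange S δ)
    (ha : ∀ x, a' (α x) = β (a x)) (hb : ∀ x, b' (β x) = δ (b x))
    (hk : ∀ r ∈ I, ∀ z, b z = 0 → r • z ∈ LinearMap.range a)
    {y : B'} (hy : b' y = 0) : ∃ z, b z = 0 ∧ y - β z ∈ LinearMap.range a' := by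
  obtain ⟨t, rfl⟩ := hβ.equiv.surjective y
  rw [hβ.equiv_baseChange_comm hδ hb, LinearEquiv.map_eq_zero_iff] at hy
  have hex := Module.Flat.lTensor_exact S (LinearMap.exact_subtype_ker_map b)
  obtain ⟨u, hu⟩ := (hex t).mp hy
  rw [← hu]
  clear hu hy
  induction u with
  | zero => exact ⟨0, by simp, by simp⟩
  | tmul s z =>
    obtain ⟨r, hr⟩ := hI s
    refine ⟨r • z, by simp, ?_⟩
    have : hβ.equiv ((LinearMap.ker b).subtype.lTensor S (s ⊗ₜ z)) - β (r • z) =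
        (s - algebraMap R S r) • β z := by
      simp [IsBaseChange.equiv_tmul, sub_smul]
    rw [this]
    refine Submodule.span_induction (p := fun t _ => t • β z ∈ LinearMap.range a') ?_ ?_ ?_ ?_ hr
    · rintro _ ⟨r, hr, rfl⟩
      obtain ⟨w, hw⟩ := hk r hr z z.2
      exact ⟨α w, by rw [ha, hw, map_smul, algebraMap_smul]⟩
    · simp
    · intro x y _ _ hx hy
      rw [add_smul]
      exact add_mem hx hy
    · intro c x _ hx
      rw [smul_eq_mul, mul_smul]
      exact Submodule.smul_mem _ _ hx
  | add u v hu hv =>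
    obtain ⟨z, hz, hz'⟩ := hu
    obtain ⟨w, hw, hw'⟩ := hv
    refine ⟨z + w, by simp [hz, hw], ?_⟩
    rw [map_add, map_add, map_add, add_sub_add_comm]
    exact add_mem hz' hw'

end

end

section

open CategoryTheory Limits
universe u

theorem CategoryTheory.ShortComplex.moduleCat_isIso_homologyMap {R : Type u} [Ring R]
    {S T : ShortComplex (ModuleCat.{u} R)} (φ : S ⟶ T)
    (hinj : ∀ z : S.X₂, S.g z = 0 → (∃ w, φ.τ₂ z = T.f w) → ∃ w, z = S.f w)
    (hsurj : ∀ y : T.X₂, T.g y = 0 → ∃ z w, S.g z = 0 ∧ y = φ.τ₂ z + T.f w) :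
    IsIso (ShortComplex.homologyMap φ) := by
  have key : ∀ (U : ShortComplex (ModuleCat.{u} R)) (x : U.homology), ∃ (z : U.cycles), U.homologyπ z = x :=
    fun U => (ModuleCat.epi_iff_surjective _).mp inferInstance
  have lift : ∀ (U : ShortComplex (ModuleCat.{u} R)) (x : U.X₂), U.g x = 0 →
      ∃ (z : U.cycles), U.iCycles z = x := by
    intro U x hx
    refine ⟨U.moduleCatCyclesIso.inv ⟨x, hx⟩, ?_⟩
    have := congrArg (fun f => f.hom ⟨x, hx⟩) U.moduleCatCyclesIso_inv_iCycles
    exact this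
  have zero : ∀ (U : ShortComplex (ModuleCat.{u} R)) (z : U.cycles),
      U.homologyπ z = 0 ↔ ∃ w, U.iCycles z = U.f w := by
    intro U z
    have h1 := (ShortComplex.exact_of_g_is_cokernel
      (ShortComplex.mk _ _ U.toCycles_comp_homologyπ) U.homologyIsCokernel)
    rw [ShortComplex.ShortExact.moduleCat_exact_iff_function_exact] at h1
    rw [h1 z]
    have h2 : ∀ w, U.iCycles (U.toCycles w) = U.f w := fun w =>
      congrArg (fun f => f.hom w) U.toCycles_i
    have h3 : Function.Injective U.iCycles := (ModuleCat.mono_iff_injective _).mp inferInstance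
    constructor
    · rintro ⟨w, rfl⟩
      exact ⟨w, h2 w⟩
    · rintro ⟨w, hw⟩
      exact ⟨w, h3 ((h2 w).trans hw.symm)⟩
  have cyc : ∀ (U : ShortComplex (ModuleCat.{u} R)) (z : U.cycles), U.g (U.iCycles z) = 0 :=
    fun U z => congrArg (fun f => f.hom z) U.iCycles_g
  have nat1 : ∀ z, T.iCycles (ShortComplex.cyclesMap φ z) = φ.τ₂ (S.iCycles z) := fun z =>
    congrArg (fun f => f.hom z) (ShortComplex.cyclesMap_i φ)
  have nat2 : ∀ z, ShortComplex.homologyMap φ (S.homologyπ z) = T.homologyπ (ShortComplex.cyclesMap φ z) := fun z =>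
    congrArg (fun f => f.hom z) (ShortComplex.homologyπ_naturality φ)
  rw [ConcreteCategory.isIso_iff_bijective]
  constructor
  · rw [injective_iff_map_eq_zero]
    intro x hx
    obtain ⟨z, rfl⟩ := key S x
    rw [nat2, zero, nat1] at hx
    exact (zero S z).mpr (hinj _ (cyc S z) hx)
  · intro x
    obtain ⟨y, rfl⟩ := key T x
    obtain ⟨z, w, hz, hy⟩ := hsurj _ (cyc T y)
    obtain ⟨z, rfl⟩ := lift S z hz
    refine ⟨S.homologyπ z, ?_⟩
    rw [nat2, eq_comm, ← sub_eq_zero, ← map_sub, zero]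
    refine ⟨w, ?_⟩
    rw [map_sub, nat1, hy, add_sub_cancel_left]

variable {R : Type u} [CommRing R]

/-- The map on derived functors of `Hom` induced by `α : M ⟶ M'`. -/
noncomputable abbrev homIntoDerivedMap {M M' : ModuleCat.{u} R} (α : M ⟶ M') (n : ℕ) :
    (homInto R M').leftDerived n ⟶ (homInto R M).leftDerived n :=
  NatTrans.leftDerived (NatTrans.rightOp ((linearYoneda R (ModuleCat.{u} R)).map α)) n

theorem isIso_homIntoDerivedMap_app {M M' X : ModuleCat.{u} R} (α : M ⟶ M')
    (P : ProjectiveResolution X) (n : ℕ) (i j : ℕ)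
    (hi : (ComplexShape.down ℕ).prev n = i) (hj : (ComplexShape.down ℕ).next n = j)
    (hinj : ∀ z : P.complex.X n ⟶ M, P.complex.d i n ≫ z = 0 →
      (∃ w, z ≫ α = P.complex.d n j ≫ w) → ∃ w, z = P.complex.d n j ≫ w)
    (hsurj : ∀ y : P.complex.X n ⟶ M', P.complex.d i n ≫ y = 0 →
      ∃ z w, P.complex.d i n ≫ z = 0 ∧ y = z ≫ α + P.complex.d n j ≫ w) :
    IsIso ((homIntoDerivedMap α n).app X) := by
  subst hi hj
  rw [ProjectiveResolution.leftDerived_app_eq _ P]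
  set ψ := (NatTrans.mapHomologicalComplex
    (NatTrans.rightOp ((linearYoneda R (ModuleCat.{u} R)).map α)) (ComplexShape.down ℕ)).app P.complex
  let ψ' := (HomologicalComplex.shortComplexFunctor (ModuleCat.{u} R)ᵒᵖ (ComplexShape.down ℕ) n).map ψ
  have h1 : IsIso (ShortComplex.homologyMap (ShortComplex.unopMap ψ')) := by
    refine ShortComplex.moduleCat_isIso_homologyMap _ ?_ ?_
    · exact hinj
    · exact hsurj
  have h2 : ShortComplex.QuasiIso (ShortComplex.unopMap ψ') := ⟨h1⟩
  have h3 : ShortComplex.QuasiIso (ShortComplex.opMap (ShortComplex.unopMap ψ')) :=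
    @ShortComplex.quasiIso_opMap _ _ _ _ _ _ _ _ h2
  have h4 : IsIso ((HomologicalComplex.homologyFunctor (ModuleCat.{u} R)ᵒᵖ (ComplexShape.down ℕ) n).map ψ) :=
    h3.isIso'
  infer_instance

end

section

open CategoryTheory Limits TensorProduct
universe u

variable {R S : Type u} [CommRing R] [CommRing S] [Algebra R S] [IsNoetherianRing R]
  [Module.FaithfullyFlat R S]

theorem isIso_homIntoDerivedMap_app_of_isBaseChange {C N : ModuleCat.{u} R} [Module S N]
    [IsScalarTower R S N] (ε : C ⟶ N) (hε : IsBaseChange S ε.hom) (X : ModuleCat.{u} R)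
    [Module.Finite R X] (n : ℕ) (I : Ideal R)
    (hI : ∀ s : S, ∃ r : R, s - algebraMap R S r ∈ I.map (algebraMap R S))
    (hk : ∀ r ∈ I, ∀ z : (FiniteFreeResolution.resolution X).complex.X n ⟶ C,
      (FiniteFreeResolution.resolution X).complex.d (n + 1) n ≫ z = 0 →
      ∃ w, r • z = (FiniteFreeResolution.resolution X).complex.d n
        ((ComplexShape.down ℕ).next n) ≫ w) :
    IsIso ((homIntoDerivedMap ε n).app X) := by
  set P := FiniteFreeResolution.resolution X with hP
  have free : ∀ k, Module.Free R (P.complex.X k) := fun k =>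
    inferInstanceAs (Module.Free R (FiniteFreeResolution.term X k))
  have fin : ∀ k, Module.Finite R (P.complex.X k) := fun k =>
    inferInstanceAs (Module.Finite R (FiniteFreeResolution.term X k))
  generalize hj : (ComplexShape.down ℕ).next n = j at hk
  have bc : ∀ k, IsBaseChange S (LinearMap.compRight R (M := P.complex.X k) ε.hom) := fun k =>
    IsBaseChange.linearMapRight (P.complex.X k) hε
  let a := LinearMap.lcomp R C (P.complex.d n j).hom
  let b := LinearMap.lcomp R C (P.complex.d (n + 1) n).hom
  let a' := LinearMap.lcomp S N (P.complex.d n j).hom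
  let b' := LinearMap.lcomp S N (P.complex.d (n + 1) n).hom
  have ha : ∀ x, a' (LinearMap.compRight R ε.hom x) = LinearMap.compRight R ε.hom (a x) :=
    fun x => rfl
  have hb : ∀ x, b' (LinearMap.compRight R ε.hom x) = LinearMap.compRight R ε.hom (b x) :=
    fun x => rfl
  refine isIso_homIntoDerivedMap_app ε P n (n + 1) j (by simp) hj ?_ ?_
  · rintro z - ⟨w, hw⟩
    obtain ⟨x, hx⟩ := (bc j).mem_range_of_mem_range (bc n) ha (y := z.hom)
      ⟨w.hom, (congrArg ModuleCat.Hom.hom hw).symm⟩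
    exact ⟨ModuleCat.ofHom x, ModuleCat.hom_ext hx.symm⟩
  · intro y hy
    obtain ⟨z, hz, w, hw⟩ := IsBaseChange.exists_cycle
      (α := LinearMap.compRight R (M := P.complex.X j) ε.hom) I hI (bc n) (bc (n + 1)) ha hb (y := y.hom) (by
        intro r hr z hz
        obtain ⟨w, hw⟩ := hk r hr (ModuleCat.ofHom z) (ModuleCat.hom_ext hz)
        exact ⟨w.hom, (congrArg ModuleCat.Hom.hom hw).symm⟩) (congrArg ModuleCat.Hom.hom hy)
    refine ⟨ModuleCat.ofHom z, ModuleCat.ofHom w, ModuleCat.hom_ext hz, ModuleCat.hom_ext ?_⟩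
    exact (sub_eq_iff_eq_add'.mp hw.symm)

omit [IsNoetherianRing R] in
/-- The annihilator of `X` annihilates `Ext(X, -)`, in terms of cocycles. -/
theorem CategoryTheory.ProjectiveResolution.exists_smul_eq_d_comp {X C : ModuleCat.{u} R}
    (P : ProjectiveResolution X) (r : R) (hr : ∀ x : X, r • x = 0) (n : ℕ)
    (z : P.complex.X n ⟶ C) (hz : P.complex.d (n + 1) n ≫ z = 0) :
    ∃ w, r • z = P.complex.d n ((ComplexShape.down ℕ).next n) ≫ w := by
  have h0 : r • 𝟙 X = 0 := by
    ext x
    exact hr x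
  have h1 : r • P.π = P.π ≫ (ChainComplex.single₀ (ModuleCat.{u} R)).map (r • 𝟙 X) := by
    apply HomologicalComplex.to_single_hom_ext
    rw [HomologicalComplex.comp_f]
    erw [ChainComplex.single₀_map_f_zero, Linear.comp_smul, Category.comp_id]
    rfl
  have h2 : (r • 𝟙 P.complex) ≫ P.π = 0 := by
    rw [Linear.smul_comp, Category.id_comp, h1, h0, Functor.map_zero, comp_zero]
  let h := P.liftHomotopyZero _ h2
  refine ⟨h.hom _ n ≫ z, ?_⟩
  have h3 : r • 𝟙 (P.complex.X n) = _ := h.comm n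
  rw [prevD_eq h.hom (j' := n + 1) (by simp)] at h3
  have h4 := congrArg (· ≫ z) h3
  simp only [Linear.smul_comp, Category.id_comp, HomologicalComplex.zero_f, add_zero,
    Preadditive.add_comp, Category.assoc, hz, comp_zero] at h4
  rw [h4]
  exact Category.assoc _ _ _

end

noncomputable section

open CategoryTheory Limits TensorProduct Opposite
universe u

variable (R S : Type u) [CommRing R] [CommRing S] [Algebra R S]

/-- The unit of the base change adjunction. -/
def baseChangeUnit (C : ModuleCat.{u} R) :
    C ⟶ (restrictFunctor R S).obj ((baseChangeFunctor R S).obj C) :=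
  (homBaseChangeEquiv C ((baseChangeFunctor R S).obj C)).symm (𝟙 _)

variable [IsNoetherianRing R] [Module.FaithfullyFlat R S]

variable {R}

theorem isIso_homIntoDerivedMap_baseChangeUnit_app {C X : ModuleCat.{u} R}
    [Module.Finite R X] (n : ℕ) (I : Ideal R)
    (hI : ∀ s : S, ∃ r : R, s - algebraMap R S r ∈ I.map (algebraMap R S))
    (hk : ∀ r ∈ I, ∀ z : (FiniteFreeResolution.resolution X).complex.X n ⟶ C,
      (FiniteFreeResolution.resolution X).complex.d (n + 1) n ≫ z = 0 →
      ∃ w, r • z = (FiniteFreeResolution.resolution X).complex.d n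
        ((ComplexShape.down ℕ).next n) ≫ w) :
    IsIso ((homIntoDerivedMap (baseChangeUnit R S C) n).app X) := by
  let _ : Module S ((restrictFunctor R S).obj ((baseChangeFunctor R S).obj C)) :=
    inferInstanceAs (Module S (S ⊗[R] C))
  have : IsScalarTower R S ((restrictFunctor R S).obj ((baseChangeFunctor R S).obj C)) :=
    IsScalarTower.of_algebraMap_smul (fun _ _ => rfl)
  refine isIso_homIntoDerivedMap_app_of_isBaseChange (S := S) _ ?_ X n I hI hk
  let e : S ⊗[R] C ≃ₗ[S] (restrictFunctor R S).obj ((baseChangeFunctor R S).obj C) :=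
    LinearEquiv.refl S (S ⊗[R] C)
  exact IsBaseChange.of_equiv e (fun x => rfl)

/-- If the ideal `I` kills `X` and `R → S / I S` is surjective, then
`Ext(X, S ⊗ C) → Ext(X, C)` is an isomorphism. -/
theorem isIso_homIntoDerivedMap_of_annihilator {C X : ModuleCat.{u} R}
    [Module.Finite R X] (n : ℕ) (I : Ideal R)
    (hI : ∀ s : S, ∃ r : R, s - algebraMap R S r ∈ I.map (algebraMap R S))
    (hX : ∀ r ∈ I, ∀ x : X, r • x = 0) :
    IsIso ((homIntoDerivedMap (baseChangeUnit R S C) n).app X) :=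
  isIso_homIntoDerivedMap_baseChangeUnit_app S n I hI
    (fun r hr z hz => ProjectiveResolution.exists_smul_eq_d_comp _ r (hX r hr) n z hz)

omit [IsNoetherianRing R] in
theorem CategoryTheory.ProjectiveResolution.exists_eq_d_comp {X C : ModuleCat.{u} R}
    (P : ProjectiveResolution X) (n : ℕ) (h : IsZero (((homInto R C).leftDerived n).obj X))
    (z : P.complex.X n ⟶ C) (hz : P.complex.d (n + 1) n ≫ z = 0) :
    ∃ w, z = P.complex.d n ((ComplexShape.down ℕ).next n) ≫ w := by
  have h1 := h.of_iso (P.isoLeftDerivedObj (homInto R C) n).symm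
  have h2 : (((homInto R C).mapHomologicalComplex (ComplexShape.down ℕ)).obj P.complex).ExactAt n := by
    rw [HomologicalComplex.exactAt_iff_isZero_homology]
    exact h1
  have h3 := ((HomologicalComplex.exactAt_iff' _ (n + 1) n ((ComplexShape.down ℕ).next n) (by simp) rfl).mp h2).unop
  rw [ShortComplex.ShortExact.moduleCat_exact_iff_function_exact] at h3
  obtain ⟨w, hw⟩ := (h3 z).mp hz
  exact ⟨w, hw.symm⟩

/-- If `Ext(X, C) = 0`, then `Ext(X, S ⊗ C) → Ext(X, C)` is an isomorphism. -/
theorem isIso_homIntoDerivedMap_of_isZero {C X : ModuleCat.{u} R}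
    [Module.Finite R X] (n : ℕ) (h : IsZero (((homInto R C).leftDerived n).obj X)) :
    IsIso ((homIntoDerivedMap (baseChangeUnit R S C) n).app X) := by
  refine isIso_homIntoDerivedMap_baseChangeUnit_app S n ⊤
    (fun s => ⟨0, by rw [Ideal.map_top]; trivial⟩) (fun r _ z hz => ?_)
  refine ProjectiveResolution.exists_eq_d_comp _ n h (r • z) ?_
  rw [Linear.comp_smul, hz, smul_zero]

omit [IsNoetherianRing R] [Module.FaithfullyFlat R S] in
theorem isZero_leftDerived_iff_subsingleton_ext (C X : ModuleCat.{u} R) (n : ℕ) :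
    IsZero (((homInto R C).leftDerived n).obj X) ↔
      Subsingleton (((Ext R (ModuleCat.{u} R) n).obj (op X)).obj C) := by
  refine Iff.trans ?_ (ModuleCat.isZero_iff_subsingleton ..)
  exact ⟨fun h => h.unop, fun h => h.op⟩

theorem subsingleton_ext_baseChange {C X : ModuleCat.{u} R}
    [Module.Finite R X] (n : ℕ)
    (h : Subsingleton (((Ext R (ModuleCat.{u} R) n).obj (op X)).obj C)) :
    Subsingleton (((Ext S (ModuleCat.{u} S) n).obj (op ((baseChangeFunctor R S).obj X))).obj
      ((baseChangeFunctor R S).obj C)) := by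
  rw [← isZero_leftDerived_iff_subsingleton_ext] at h
  have := isIso_homIntoDerivedMap_of_isZero S n h
  have h1 := h.of_iso (asIso ((homIntoDerivedMap (baseChangeUnit R S C) n).app X))
  have h2 := h1.of_iso ((leftDerivedHomIntoIso R S ((baseChangeFunctor R S).obj C) n).app X)
  have h3 := (ModuleCat.isZero_iff_subsingleton ..).mp h2.unop
  exact h3

end

noncomputable section

open CategoryTheory Limits TensorProduct Opposite
universe u

theorem lsmul_baseChange_bijective {R : Type*} (S : Type*) {C : Type*} [CommRing R] [CommRing S] [Algebra R S]
    [Module.Flat R S] [AddCommGroup C] [Module R C] [Module.FinitePresentation R C]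
    (h : Function.Bijective (LinearMap.lsmul R C)) :
    Function.Bijective (LinearMap.lsmul S (S ⊗[R] C)) := by
  have h1 : IsBaseChange S (LinearMap.baseChangeHom R S C C) :=
    Module.FinitePresentation.isBaseChange_map R C C S
  let e : R ≃ₗ[R] (C →ₗ[R] C) := LinearEquiv.ofBijective (LinearMap.lsmul R C) h
  let e' := (AlgebraTensorModule.rid R S S).symm ≪≫ₗ e.baseChange R S _ _ ≪≫ₗ h1.equiv
  convert e'.bijective
  ext s x
  simp [e', e, IsBaseChange.equiv_tmul]

/-- Faithfully flat base change preserves semidualizing modules. -/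
theorem IsSemidualizing.baseChange {R : Type u} (S : Type u) [CommRing R] [IsNoetherianRing R] [CommRing S]
    [Algebra R S] [Module.FaithfullyFlat R S] {C : ModuleCat.{u} R} (hC : IsSemidualizing R C) :
    IsSemidualizing S (ModuleCat.of S (S ⊗[R] C)) := by
  obtain ⟨h1, h2, h3⟩ := hC
  have : Module.FinitePresentation R C := Module.finitePresentation_of_finite R C
  exact ⟨inferInstanceAs (Module.Finite S (S ⊗[R] C)), lsmul_baseChange_bijective S h2,
    fun i hi => subsingleton_ext_baseChange S i (h3 i hi)⟩

end

noncomputable section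

open CategoryTheory Limits TensorProduct Opposite
universe u

/-- The direct system computing `H_J^i(N)`. -/
abbrev localCohomologySystem {R : Type u} [CommRing R] (J : Ideal R) (i : ℕ) (N : ModuleCat.{u} R) :
    (ℕᵒᵖ)ᵒᵖ ⥤ ModuleCat.{u} R :=
  (localCohomology.ringModIdeals (localCohomology.idealPowersDiagram J)).op ⋙
    ((homInto R N).leftDerived i).leftOp

/-- `H_J^i(N)` is the colimit of `Ext^i(R / J ^ t, N)`. -/
def localCohomologyObjIso {R : Type u} [CommRing R] (J : Ideal R) (i : ℕ) (N : ModuleCat.{u} R) :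
    (localCohomology J i).obj N ≅ colimit (localCohomologySystem J i N) :=
  haveI := localCohomology.hasColimitDiagram.{u, 0} (localCohomology.idealPowersDiagram J) i
  colimitObjIsoColimitCompEvaluation _ N

variable {R : Type u} (S : Type u) [CommRing R] [CommRing S] [Algebra R S]

theorem qoutMapEquivTensorQout_mk (I : Ideal R) (s : S) :
    Ideal.qoutMapEquivTensorQout S (I := I) (Ideal.Quotient.mk _ s) = s ⊗ₜ[R] (1 : R ⧸ I) := by
  have : Ideal.qoutMapEquivTensorQout S (I := I) (Ideal.Quotient.mk _ 1) = 1 ⊗ₜ[R] (1 : R ⧸ I) := by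
    rfl
  have h2 := congrArg (s • ·) this
  simp only [← map_smul, TensorProduct.smul_tmul', smul_eq_mul, mul_one] at h2
  refine Eq.trans (congrArg _ ?_) h2
  change _ = Ideal.Quotient.mk _ (s * 1)
  rw [mul_one]

/-- `S / (J S)^t` is the base change of `R / J^t`, naturally in `t`. -/
def ringModIdealsBaseChangeIso (J : Ideal R) :
    localCohomology.ringModIdeals (localCohomology.idealPowersDiagram (J.map (algebraMap R S))) ≅
    localCohomology.ringModIdeals (localCohomology.idealPowersDiagram J) ⋙ baseChangeFunctor R S :=
  NatIso.ofComponents (fun t => LinearEquiv.toModuleIso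
    (Submodule.quotEquivOfEq _ _ (Ideal.map_pow (algebraMap R S) J t.unop).symm ≪≫ₗ
      Ideal.qoutMapEquivTensorQout S)) (fun {s t} f => by
    refine ModuleCat.hom_ext (Submodule.linearMap_qext _ (LinearMap.ext_ring ?_))
    refine Eq.trans (qoutMapEquivTensorQout_mk S (J ^ t.unop) 1) ?_
    refine Eq.trans ?_ (congrArg (LinearMap.baseChange S (ModuleCat.Hom.hom
      ((localCohomology.ringModIdeals (localCohomology.idealPowersDiagram J)).map f)))
      (qoutMapEquivTensorQout_mk S (J ^ s.unop) 1).symm)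
    rfl)

variable [IsNoetherianRing R] [Module.FaithfullyFlat R S]

/-- Base change of the direct system computing local cohomology. -/
def localCohomologySystemIso (J : Ideal R) (hJ : IdealDense S J) (i : ℕ) (C : ModuleCat.{u} R) :
    localCohomologySystem (J.map (algebraMap R S)) i ((baseChangeFunctor R S).obj C) ⋙
      restrictFunctor R S ≅ localCohomologySystem J i C :=
  have h : ∀ t, IsIso ((Functor.whiskerLeft
      (localCohomology.ringModIdeals (localCohomology.idealPowersDiagram J))
      (homIntoDerivedMap (baseChangeUnit R S C) i)).app t) := fun t =>
    haveI : Module.Finite R ((localCohomology.ringModIdeals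
      (localCohomology.idealPowersDiagram J)).obj t) :=
        inferInstanceAs (Module.Finite R (R ⧸ J ^ t.unop))
    isIso_homIntoDerivedMap_of_annihilator S i (J ^ t.unop)
      (fun s => by rw [Ideal.map_pow]; exact hJ t.unop s)
      (fun r hr x => by
        obtain ⟨y, rfl⟩ := Ideal.Quotient.mk_surjective x
        change (Ideal.Quotient.mk (J ^ t.unop)) (r * y) = 0
        rw [Ideal.Quotient.eq_zero_iff_mem]
        exact Ideal.mul_mem_right _ _ hr)
  haveI := NatIso.isIso_of_isIso_app (Functor.whiskerLeft
      (localCohomology.ringModIdeals (localCohomology.idealPowersDiagram J))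
      (homIntoDerivedMap (baseChangeUnit R S C) i))
  let e : localCohomology.ringModIdeals (localCohomology.idealPowersDiagram (J.map (algebraMap R S))) ⋙
      (homInto S ((baseChangeFunctor R S).obj C)).leftDerived i ⋙ (restrictFunctor R S).op ≅
      localCohomology.ringModIdeals (localCohomology.idealPowersDiagram J) ⋙
        (homInto R C).leftDerived i :=
    Functor.isoWhiskerRight (ringModIdealsBaseChangeIso S J) _ ≪≫
    Functor.isoWhiskerLeft (localCohomology.ringModIdeals (localCohomology.idealPowersDiagram J))
      (leftDerivedHomIntoIso R S ((baseChangeFunctor R S).obj C) i) ≪≫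
    asIso (Functor.whiskerLeft _ (homIntoDerivedMap (baseChangeUnit R S C) i))
  { hom := NatTrans.leftOp e.inv
    inv := NatTrans.leftOp e.hom
    hom_inv_id := (NatTrans.leftOp_comp e.hom e.inv).symm.trans
      ((congrArg NatTrans.leftOp e.hom_inv_id).trans (NatTrans.leftOp_id))
    inv_hom_id := (NatTrans.leftOp_comp e.inv e.hom).symm.trans
      ((congrArg NatTrans.leftOp e.inv_hom_id).trans (NatTrans.leftOp_id)) }

/-- `H_{J S}^i(S ⊗ C)`, viewed as an `R`-module, is `H_J^i(C)`. -/
def localCohomologyBaseChangeIso (J : Ideal R) (hJ : IdealDense S J) (i : ℕ) (C : ModuleCat.{u} R) :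
    (restrictFunctor R S).obj ((localCohomology (J.map (algebraMap R S)) i).obj
      ((baseChangeFunctor R S).obj C)) ≅ (localCohomology J i).obj C :=
  (restrictFunctor R S).mapIso (localCohomologyObjIso _ _ _) ≪≫
    preservesColimitIso (restrictFunctor R S) _ ≪≫
    HasColimit.isoOfNatIso (localCohomologySystemIso S J hJ i C) ≪≫
    (localCohomologyObjIso J i C).symm

end

section

open CategoryTheory Limits TensorProduct Opposite
universe u

variable {R : Type u} [CommRing R]

/-- The annihilator of `X` annihilates `Ext(X, C)`. -/
theorem smul_leftDerived_homInto_eq_zero {X C : ModuleCat.{u} R} (r : R) (hr : ∀ x : X, r • x = 0)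
    (n : ℕ) (y : (((homInto R C).leftDerived n).obj X).unop) : r • y = 0 := by
  let P := projectiveResolution X
  let T := (((homInto R C).mapHomologicalComplex (ComplexShape.down ℕ)).obj P.complex).sc n
  let e : ((homInto R C).leftDerived n).obj X ≅ op T.unop.moduleCatLeftHomologyData.H :=
    P.isoLeftDerivedObj (homInto R C) n ≪≫ T.unop.homologyOpIso ≪≫
      (T.unop.moduleCatHomologyIso).symm.op
  obtain ⟨z, rfl⟩ : ∃ z, e.hom.unop z = y := ⟨e.inv.unop y,
    congrArg (fun f => f.unop y) e.hom_inv_id⟩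
  rw [← map_smul]
  obtain ⟨z, rfl⟩ := Submodule.mkQ_surjective _ z
  have hz : P.complex.d (n + 1) n ≫ z.1 = 0 := by
    have h : ∀ k, k = n + 1 → P.complex.d k n ≫ z.1 = 0 → P.complex.d (n + 1) n ≫ z.1 = 0 := by
      rintro _ rfl h
      exact h
    exact h ((ComplexShape.down ℕ).prev n) (by simp) z.2
  obtain ⟨w, hw⟩ := P.exists_smul_eq_d_comp r hr n z.1 hz
  have : Submodule.mkQ (LinearMap.range T.unop.moduleCatToCycles) (r • z) = 0 := by
    rw [Submodule.mkQ_apply, Submodule.Quotient.mk_eq_zero]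
    exact ⟨w, Subtype.ext hw.symm⟩
  exact (congrArg _ this).trans (map_zero _)

instance : IsFiltered (ℕᵒᵖ)ᵒᵖ := inferInstance

theorem localCohomology_isTorsion (J : Ideal R) (i : ℕ) (N : ModuleCat.{u} R)
    (x : (localCohomology J i).obj N) : ∃ t : ℕ, ∀ r ∈ J ^ t, r • x = 0 := by
  let e := localCohomologyObjIso J i N
  obtain ⟨y, rfl⟩ : ∃ y, e.inv y = x := ⟨e.hom x, congrArg (fun f => f.hom x) e.hom_inv_id⟩
  have := preservesSmallestFilteredColimits_of_preservesFilteredColimits (forget (ModuleCat.{u} R))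
  have : PreservesColimit (localCohomologySystem J i N) (forget (ModuleCat.{u} R)) := inferInstance
  obtain ⟨t, z, rfl⟩ := Concrete.colimit_exists_rep _ y
  refine ⟨t.unop.unop, fun r hr => ?_⟩
  rw [← map_smul]
  have h : r • z = 0 := smul_leftDerived_homInto_eq_zero (C := N) r (fun x => by
        obtain ⟨y, rfl⟩ := Ideal.Quotient.mk_surjective x
        change (Ideal.Quotient.mk (J ^ t.unop.unop)) (r * y) = 0
        rw [Ideal.Quotient.eq_zero_iff_mem]
        exact Ideal.mul_mem_right _ _ hr) i z
  refine Eq.trans (congrArg e.inv.hom ?_) (map_zero e.inv.hom)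
  exact (map_smul (colimit.ι (localCohomologySystem J i N) t).hom r z).symm.trans
    ((congrArg _ h).trans (map_zero (colimit.ι (localCohomologySystem J i N) t).hom))

end

noncomputable section

open TensorProduct
universe u

section
variable {R : Type*} [CommRing R] (I : Ideal R) (M : Type*) [AddCommGroup M] [Module R M]

/-- Every element of `M` is killed by a power of `I`. -/
def IsPowTorsion : Prop := ∀ x : M, ∃ t : ℕ, ∀ r ∈ I ^ t, r • x = 0

/-- The submodule of elements killed by a power of `I`. -/
def powTorsion : Submodule R M where
  carrier := {x | ∃ t : ℕ, ∀ r ∈ I ^ t, r • x = 0}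
  zero_mem' := ⟨0, by simp⟩
  add_mem' := by
    rintro x y ⟨s, hs⟩ ⟨t, ht⟩
    refine ⟨s + t, fun r hr => ?_⟩
    rw [smul_add, hs r (Ideal.pow_le_pow_right (by simp) hr),
      ht r (Ideal.pow_le_pow_right (by simp) hr), add_zero]
  smul_mem' := by
    rintro c x ⟨t, ht⟩
    exact ⟨t, fun r hr => by rw [smul_comm, ht r hr, smul_zero]⟩

theorem isPowTorsion_powTorsion : IsPowTorsion I (powTorsion I M) := by
  rintro ⟨x, t, ht⟩
  exact ⟨t, fun r hr => Subtype.ext (ht r hr)⟩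

variable {I M}

/-- A map from a finite module to an `I`-power torsion module is killed by a power of `I`. -/
theorem IsPowTorsion.exists_smul_eq_zero {N : Type*} [AddCommGroup N] [Module R N] [Module.Finite R N]
    (f : N →ₗ[R] M) (hf : ∀ x, ∃ t : ℕ, ∀ r ∈ I ^ t, r • f x = 0) :
    ∃ t : ℕ, ∀ r ∈ I ^ t, ∀ x, r • f x = 0 := by
  obtain ⟨n, s, hs⟩ := Module.Finite.exists_fin (R := R) (M := N)
  choose t ht using fun i => hf (s i)
  refine ⟨∑ i, t i, fun r hr x => ?_⟩
  have hx : x ∈ Submodule.span R (Set.range s) := by rw [hs]; trivial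
  induction hx using Submodule.span_induction with
  | mem x hx =>
    obtain ⟨i, rfl⟩ := hx
    exact ht i r (Ideal.pow_le_pow_right (Finset.single_le_sum (f := t) (by simp) (Finset.mem_univ i)) hr)
  | zero => simp
  | add x y _ _ hx hy => rw [map_add, smul_add, hx, hy, add_zero]
  | smul c x _ hx => rw [map_smul, smul_comm, hx, smul_zero]

/-- A map from an ideal to an `I`-power torsion module vanishes on the elements of a large power of `I`. -/
theorem IsPowTorsion.exists_eq_zero_of_mem_pow [IsNoetherianRing R] (hM : IsPowTorsion I M)
    {A : Ideal R} (g : A →ₗ[R] M) : ∃ k : ℕ, ∀ x : A, (x : R) ∈ I ^ k → g x = 0 := by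
  obtain ⟨t, ht⟩ := IsPowTorsion.exists_smul_eq_zero g (fun x => hM (g x))
  obtain ⟨k, hk⟩ := Ideal.exists_pow_inf_eq_pow_smul I A
  refine ⟨t + k, fun x hx => ?_⟩
  have h1 : (x : R) ∈ I ^ (t + k) • (⊤ : Submodule R R) ⊓ A := ⟨by simpa using hx, x.2⟩
  rw [hk _ (by lia), Nat.add_sub_cancel] at h1
  have h2 : (x : R) ∈ (I ^ t • (⊤ : Submodule R A)).map A.subtype := by
    rw [Submodule.map_smul'', Submodule.map_top, Submodule.range_subtype]
    exact Submodule.smul_mono le_rfl inf_le_right h1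
  obtain ⟨y, hy, hyx⟩ := h2
  rw [← Subtype.ext hyx]
  refine Submodule.smul_induction_on hy (fun r hr n _ => ?_) (fun x y hx hy => ?_)
  · rw [map_smul, ht r hr]
  · rw [map_add, hx, hy, add_zero]

end

/-- Maps into an injective module extend along maps whose kernel they vanish on. -/
theorem Module.Injective.exists_extension {R : Type u} [CommRing R] {E X Y : Type u} [AddCommGroup E]
    [Module R E] [AddCommGroup X] [Module R X] [AddCommGroup Y] [Module R Y]
    (hE : Module.Injective R E) (φ : X →ₗ[R] Y) (g : X →ₗ[R] E) (h : ∀ x, φ x = 0 → g x = 0) :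
    ∃ g' : Y →ₗ[R] E, ∀ x, g' (φ x) = g x := by
  obtain ⟨g', hg'⟩ := hE.out ((LinearMap.ker φ).liftQ φ le_rfl)
    (LinearMap.ker_eq_bot.mp (Submodule.ker_liftQ_eq_bot _ _ _ le_rfl))
    ((LinearMap.ker φ).liftQ g (fun x hx => h x hx))
  exact ⟨g', fun x => hg' (Submodule.Quotient.mk x)⟩

theorem smul_quotient_eq_zero {R : Type*} [CommRing R] (I : Ideal R) {r : R} (hr : r ∈ I) (x : R ⧸ I) : r • x = 0 := by
  obtain ⟨y, rfl⟩ := Ideal.Quotient.mk_surjective x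
  change Ideal.Quotient.mk I (r * y) = 0
  rw [Ideal.Quotient.eq_zero_iff_mem]
  exact Ideal.mul_mem_right _ _ hr

/-- The torsion submodule of an injective module over a Noetherian ring is injective. -/
theorem injective_powTorsion {R : Type u} [CommRing R] [IsNoetherianRing R] (I : Ideal R) (E : Type u)
    [AddCommGroup E] [Module R E] (hE : Module.Injective R E) :
    Module.Injective R (powTorsion I E) := by
  refine Module.Baer.injective fun A g => ?_
  obtain ⟨k, hk⟩ := (isPowTorsion_powTorsion I E).exists_eq_zero_of_mem_pow g
  obtain ⟨h, hh⟩ := hE.exists_extension ((I ^ k).mkQ ∘ₗ A.subtype) ((powTorsion I E).subtype ∘ₗ g)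
    (fun x hx => by
      have : (x : R) ∈ I ^ k := Ideal.Quotient.eq_zero_iff_mem.mp hx
      simp [hk x this])
  have h1 : ∀ y, h y ∈ powTorsion I E := fun y =>
    ⟨k, fun r hr => by rw [← map_smul, smul_quotient_eq_zero _ hr, map_zero]⟩
  exact ⟨h.codRestrict _ h1 ∘ₗ (I ^ k).mkQ, fun x hx => Subtype.ext (hh ⟨x, hx⟩)⟩

section
variable {R : Type*} {S : Type*} [CommRing R] [CommRing S] [Algebra R S] {I : Ideal R}

/-- An `R`-linear map between power torsion `S`-modules is `S`-linear if `R` is dense in `S`. -/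
theorem IdealDense.map_smul_of_isPowTorsion (hI : IdealDense S I) {M N : Type*} [AddCommGroup M] [AddCommGroup N]
    [Module R M] [Module R N] [Module S M] [Module S N] [IsScalarTower R S M] [IsScalarTower R S N]
    (hM : IsPowTorsion (I.map (algebraMap R S)) M) (hN : IsPowTorsion (I.map (algebraMap R S)) N)
    (f : M →ₗ[R] N) (s : S) (x : M) : f (s • x) = s • f x := by
  obtain ⟨k, hk⟩ := hM x
  obtain ⟨l, hl⟩ := hN (f x)
  obtain ⟨r, hr⟩ := hI (k + l) s
  have h1 := hk _ (Ideal.pow_le_pow_right (by simp) hr)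
  have h2 := hl _ (Ideal.pow_le_pow_right (by simp) hr)
  rw [sub_smul, sub_eq_zero, algebraMap_smul] at h1 h2
  rw [h1, h2, map_smul]

/-- Power torsion `S`-modules that are isomorphic over `R` are isomorphic over `S`. -/
def IdealDense.linearEquiv (hI : IdealDense S I) {M N : Type*} [AddCommGroup M] [AddCommGroup N]
    [Module R M] [Module R N] [Module S M] [Module S N] [IsScalarTower R S M] [IsScalarTower R S N]
    (hM : IsPowTorsion (I.map (algebraMap R S)) M) (hN : IsPowTorsion (I.map (algebraMap R S)) N)
    (e : M ≃ₗ[R] N) : M ≃ₗ[S] N :=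
  { e with map_smul' := hI.map_smul_of_isPowTorsion hM hN e.toLinearMap }

theorem IdealDense.bijective_mk (hI : IdealDense S I) [Module.FaithfullyFlat R S] {M : Type*} [AddCommGroup M]
    [Module R M] (hM : IsPowTorsion I M) : Function.Bijective (TensorProduct.mk R S M 1) := by
  refine ⟨Module.FaithfullyFlat.tensorProduct_mk_injective M, fun y => ?_⟩
  induction y with
  | zero => exact ⟨0, by simp⟩
  | add x y hx hy =>
    obtain ⟨x, rfl⟩ := hx
    obtain ⟨y, rfl⟩ := hy
    exact ⟨x + y, map_add _ x y⟩
  | tmul s x =>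
    obtain ⟨k, hk⟩ := hM x
    obtain ⟨r, hr⟩ := hI k s
    refine ⟨r • x, ?_⟩
    rw [← sub_eq_zero, ← neg_eq_zero, neg_sub]
    have : s ⊗ₜ[R] x - TensorProduct.mk R S M 1 (r • x) = (s - algebraMap R S r) ⊗ₜ x := by
      simp [sub_tmul, Algebra.algebraMap_eq_smul_one, smul_tmul]
    rw [this]
    rw [← Ideal.map_pow] at hr
    refine Submodule.span_induction (p := fun t _ => t ⊗ₜ[R] x = 0) ?_ (by simp) ?_ ?_ hr
    · rintro _ ⟨r, hr, rfl⟩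
      rw [Algebra.algebraMap_eq_smul_one, smul_tmul, hk r hr, tmul_zero]
    · intro a b _ _ ha hb
      rw [add_tmul, ha, hb, add_zero]
    · intro c a _ ha
      rw [← TensorProduct.smul_tmul', ha, smul_zero]

end

section
variable {R S : Type u} [CommRing R] [CommRing S] [Algebra R S] {I : Ideal R}

/-- A power torsion `S`-module that is injective over `R` is injective over `S`. -/
theorem IdealDense.injective (hI : IdealDense S I) [IsNoetherianRing S] {M : Type u} [AddCommGroup M]
    [Module R M] [Module S M] [IsScalarTower R S M] (hM : IsPowTorsion (I.map (algebraMap R S)) M)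
    (hE : Module.Injective R M) : Module.Injective S M := by
  refine Module.Baer.injective fun A g => ?_
  obtain ⟨k, hk⟩ := hM.exists_eq_zero_of_mem_pow g
  obtain ⟨h, hh⟩ := hE.exists_extension
    (((I.map (algebraMap R S) ^ k).mkQ ∘ₗ A.subtype).restrictScalars R) (g.restrictScalars R)
    (fun x hx => by
      have : (x : S) ∈ I.map (algebraMap R S) ^ k := Ideal.Quotient.eq_zero_iff_mem.mp hx
      simp [hk x this])
  have h1 : IsPowTorsion (I.map (algebraMap R S)) (S ⧸ I.map (algebraMap R S) ^ k) :=
    fun y => ⟨k, fun r hr => smul_quotient_eq_zero _ hr y⟩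
  let h' : (S ⧸ I.map (algebraMap R S) ^ k) →ₗ[S] M :=
    { h with map_smul' := hI.map_smul_of_isPowTorsion h1 hM h }
  exact ⟨h' ∘ₗ (I.map (algebraMap R S) ^ k).mkQ, fun x hx => hh ⟨x, hx⟩⟩

end

end

noncomputable section

open CategoryTheory TensorProduct
universe u

section
variable {R : Type*} {S : Type*} [CommRing R] [CommRing S] [Algebra R S] {I : Ideal R}

/-- Power torsion may be tested over the base ring. -/
theorem IsPowTorsion.map {M : Type*} [AddCommGroup M] [Module R M] [Module S M] [IsScalarTower R S M]
    (hM : IsPowTorsion I M) : IsPowTorsion (I.map (algebraMap R S)) M := by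
  intro x
  obtain ⟨t, ht⟩ := hM x
  refine ⟨t, fun s hs => ?_⟩
  rw [← Ideal.map_pow] at hs
  have : (I ^ t).map (algebraMap R S) ≤ LinearMap.ker (LinearMap.toSpanSingleton S M x) :=
    Ideal.map_le_iff_le_comap.mpr fun r hr => by
      simpa using ht r hr
  simpa using this hs

theorem IsPowTorsion.of_linearEquiv {M N : Type*} [AddCommGroup M] [Module R M] [AddCommGroup N]
    [Module R N] (hM : IsPowTorsion I M) (e : M ≃ₗ[R] N) : IsPowTorsion I N := by
  intro x
  obtain ⟨t, ht⟩ := hM (e.symm x)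
  exact ⟨t, fun r hr => by rw [← e.apply_symm_apply x, ← map_smul, ht r hr, map_zero]⟩

theorem IsPowTorsion.linearMap {C M : Type*} [AddCommGroup C] [Module R C] [Module.Finite R C]
    [AddCommGroup M] [Module R M] (hM : IsPowTorsion I M) : IsPowTorsion I (C →ₗ[R] M) := by
  intro f
  obtain ⟨t, ht⟩ := IsPowTorsion.exists_smul_eq_zero f (fun x => hM (f x))
  exact ⟨t, fun r hr => LinearMap.ext (ht r hr)⟩

/-- If `Hom(C, E)` is power torsion, every map from `C` to `E` lands in the torsion of `E`. -/
def powTorsionHomEquiv {C E : Type*} [AddCommGroup C] [Module R C]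
    [AddCommGroup E] [Module R E] (h : IsPowTorsion I (C →ₗ[R] E)) :
    (C →ₗ[R] powTorsion I E) ≃ₗ[R] (C →ₗ[R] E) :=
  LinearEquiv.ofBijective (LinearMap.compRight R (powTorsion I E).subtype) (by
    refine ⟨fun f g hfg => LinearMap.ext fun x => Subtype.ext (LinearMap.congr_fun hfg x), fun f => ?_⟩
    obtain ⟨t, ht⟩ := h f
    exact ⟨f.codRestrict _ (fun x => ⟨t, fun r hr => LinearMap.congr_fun (ht r hr) x⟩), rfl⟩)

end

section
variable {R S : Type u} [CommRing R] [CommRing S] [Algebra R S] {I : Ideal R}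

/-- Restriction of scalars along a flat algebra preserves injective modules. -/
theorem Module.Injective.of_flat [Module.Flat R S] {M : Type u} [AddCommGroup M] [Module R M] [Module S M]
    [IsScalarTower R S M] (hM : Module.Injective S M) : Module.Injective R M := by
  refine ⟨fun X Y _ _ _ _ φ hφ g => ?_⟩
  obtain ⟨h, hh⟩ := hM.out (φ.baseChange S) (Module.Flat.lTensor_preserves_injective_linearMap φ hφ)
    (LinearMap.liftBaseChangeEquiv S g)
  exact ⟨(LinearMap.liftBaseChangeEquiv S).symm h, fun x => by simpa using hh (1 ⊗ₜ x)⟩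

variable [IsNoetherianRing R] [IsNoetherianRing S] [Module.FaithfullyFlat R S]

/-- If `H = Hom(C, E)` is power torsion over `R` and `H'` is an `S`-module isomorphic to `H` over
`R`, then `H'` is `(S ⊗ C)`-injective. -/
theorem IdealDense.exists_injective (hI : IdealDense S I) {C H H' E : Type u} [AddCommGroup C] [Module R C]
    [Module.Finite R C] [AddCommGroup H] [Module R H] [AddCommGroup H'] [Module R H'] [Module S H']
    [IsScalarTower R S H'] (hH : IsPowTorsion I H) (e : H' ≃ₗ[R] H)
    [AddCommGroup E] [Module R E] (hE : Module.Injective R E) (ψ : H ≃ₗ[R] (C →ₗ[R] E)) :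
    Module.Injective S (S ⊗[R] powTorsion I E) ∧
      Nonempty (H' ≃ₗ[S] (S ⊗[R] C →ₗ[S] S ⊗[R] powTorsion I E)) := by
  have hΓ := isPowTorsion_powTorsion I E
  let j : powTorsion I E ≃ₗ[R] S ⊗[R] powTorsion I E :=
    LinearEquiv.ofBijective _ (hI.bijective_mk hΓ)
  have ht : IsPowTorsion (I.map (algebraMap R S)) (S ⊗[R] powTorsion I E) :=
    (hΓ.of_linearEquiv j).map
  refine ⟨hI.injective ht ((Module.Baer.of_injective (injective_powTorsion I E hE)).of_equiv j).injective, ⟨?_⟩⟩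
  exact hI.linearEquiv (hH.of_linearEquiv e.symm).map ht.linearMap
    (e ≪≫ₗ ψ ≪≫ₗ (powTorsionHomEquiv (hH.of_linearEquiv ψ)).symm ≪≫ₗ LinearEquiv.congrRight j ≪≫ₗ
      (LinearMap.liftBaseChangeEquiv S).restrictScalars R)

end

section
variable {R : Type u} (S : Type u) [CommRing R] [CommRing S] [Algebra R S] {I : Ideal R}
  [IsNoetherianRing R] [IsNoetherianRing S] [Module.FaithfullyFlat R S]

/-- Local cohomology of `C` is `C`-injective iff it is so after base change along `S`. -/
theorem isCInjective_localCohomology_baseChange_iff (hI : IdealDense S I) (d : ℕ) (C : ModuleCat.{u} R)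
    [Module.Finite R C] :
    IsCInjective R C ((localCohomology I d).obj C) ↔
      IsCInjective S (ModuleCat.of S (S ⊗[R] C))
        ((localCohomology (I.map (algebraMap R S)) d).obj (ModuleCat.of S (S ⊗[R] C))) := by
  let H' := (localCohomology (I.map (algebraMap R S)) d).obj (ModuleCat.of S (S ⊗[R] C))
  let e : (restrictFunctor R S).obj H' ≃ₗ[R] (localCohomology I d).obj C :=
    (localCohomologyBaseChangeIso S I hI d C).toLinearEquiv
  let _ : Module S ((restrictFunctor R S).obj H') := inferInstanceAs (Module S H')
  have : IsScalarTower R S ((restrictFunctor R S).obj H') :=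
    IsScalarTower.of_algebraMap_smul (fun _ _ => rfl)
  constructor
  · rintro ⟨E, hE, ⟨ψ⟩⟩
    obtain ⟨h1, ⟨h2⟩⟩ := hI.exists_injective (localCohomology_isTorsion I d C) e hE ψ
    exact ⟨ModuleCat.of S (S ⊗[R] powTorsion I E), h1, ⟨h2⟩⟩
  · rintro ⟨E, hE, ⟨ψ⟩⟩
    let _ : Module S ((restrictFunctor R S).obj E) := inferInstanceAs (Module S E)
    have : IsScalarTower R S ((restrictFunctor R S).obj E) :=
      IsScalarTower.of_algebraMap_smul (fun _ _ => rfl)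
    have hE' : Module.Injective S ((restrictFunctor R S).obj E) := hE
    let ψ' : (restrictFunctor R S).obj H' ≃ₗ[S] (S ⊗[R] C →ₗ[S] (restrictFunctor R S).obj E) := ψ
    exact ⟨(restrictFunctor R S).obj E, hE'.of_flat, ⟨e.symm ≪≫ₗ ψ'.restrictScalars R ≪≫ₗ
      ((LinearMap.liftBaseChangeEquiv S).restrictScalars R).symm⟩⟩

end

end

noncomputable section
open CategoryTheory TensorProduct

/-- For a Cohen-Macaulay local ring of dimension `d` and a semidualizing
module `C`: `C ⊗_R R̂` is semidualizing over the completion `R̂`, and `H_m^d(C)` is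
`C`-injective over `R` iff `H_{m R̂}^d(C ⊗_R R̂)` is `(C ⊗_R R̂)`-injective over `R̂`. -/
theorem stmt_14 (R : Type u) [CommRing R] [IsNoetherianRing R] [IsLocalRing R]
    (hCM : IsCohenMacaulayLocalRing R) (d : ℕ)
    (hdim : ringKrullDim R = (d : WithBot ℕ∞))
    (C : ModuleCat.{u} R) (hC : IsSemidualizing R C) :
    IsSemidualizing (AdicCompletion (IsLocalRing.maximalIdeal R) R)
      (ModuleCat.of (AdicCompletion (IsLocalRing.maximalIdeal R) R)
        ((AdicCompletion (IsLocalRing.maximalIdeal R) R) ⊗[R] ↥C)) ∧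
    (IsCInjective R C ((localCohomology (IsLocalRing.maximalIdeal R) d).obj C) ↔
      IsCInjective (AdicCompletion (IsLocalRing.maximalIdeal R) R)
        (ModuleCat.of (AdicCompletion (IsLocalRing.maximalIdeal R) R)
          ((AdicCompletion (IsLocalRing.maximalIdeal R) R) ⊗[R] ↥C))
        ((localCohomology
            (Ideal.map (algebraMap R (AdicCompletion (IsLocalRing.maximalIdeal R) R))
              (IsLocalRing.maximalIdeal R)) d).obj
          (ModuleCat.of (AdicCompletion (IsLocalRing.maximalIdeal R) R)
            ((AdicCompletion (IsLocalRing.maximalIdeal R) R) ⊗[R] ↥C)))) := by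
  have := isNoetherianRing_adicCompletion R
  have := faithfullyFlat_adicCompletion R
  have := hC.1
  exact ⟨hC.baseChange _, isCInjective_localCohomology_baseChange_iff _
    (idealDense_adicCompletion R (IsLocalRing.maximalIdeal R)) d C⟩

end
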